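/- arXiv:1312.0021 — 5 statements merged into one kernel-verified Lean document; each statement's English description precedes it below -/
import Mathlib

section
/- Fix integers l ≥ 1, e ≥ 2, a multicharge s ∈ ℤ^l, an l-partition λ and i ∈ {0,…,e−1}. Suppose γ is the good addable i-node of λ for the residue-mod-e crystal structure (so that the e-crystal operator f̃_i adds γ to λ). Then γ is also the good addable j-node of λ for the e = ∞ structure, where j = cont(γ) is the content of γ; that is, the node added by the ∞-crystal operator f̃_j^∞ is the same node γ. -/
namespace FockCrystal

/-- A partition: `part a` is the `a`-th part, for `a ≥ 1`; `part 0` is a dummy value `0`. -/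
structure Partition where
  part : ℕ → ℕ
  part_zero : part 0 = 0
  antitone : ∀ a : ℕ, 1 ≤ a → part (a + 1) ≤ part a
  eventually_zero : ∃ N : ℕ, ∀ a : ℕ, N ≤ a → part a = 0

/-- A multipartition with `l + 1` components. -/
abbrev MultiPartition (l : ℕ) := Fin (l + 1) → Partition

/-- A node `(a, b, c)`: row `a ≥ 1`, column `b ≥ 1`, component `c`. -/
structure Node (l : ℕ) where
  row : ℕ
  col : ℕ
  comp : Fin (l + 1)

variable {l : ℕ}

def IsNode (Λ : MultiPartition l) (γ : Node l) : Prop :=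
  1 ≤ γ.row ∧ 1 ≤ γ.col ∧ γ.col ≤ (Λ γ.comp).part γ.row

/-- The content `b − a + s_c` of a node. -/
def content (s : Fin (l + 1) → ℤ) (γ : Node l) : ℤ :=
  (γ.col : ℤ) - (γ.row : ℤ) + s γ.comp

/-- `γ` is a removable node of `Λ`. -/
def Removable (Λ : MultiPartition l) (γ : Node l) : Prop :=
  1 ≤ γ.row ∧ 1 ≤ γ.col ∧ γ.col = (Λ γ.comp).part γ.row ∧
    (Λ γ.comp).part (γ.row + 1) < (Λ γ.comp).part γ.row

/-- `γ` is an addable node of `Λ`. -/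
def Addable (Λ : MultiPartition l) (γ : Node l) : Prop :=
  1 ≤ γ.row ∧ γ.col = (Λ γ.comp).part γ.row + 1 ∧
    (γ.row = 1 ∨ (Λ γ.comp).part γ.row < (Λ γ.comp).part (γ.row - 1))

/-- The strict order `≺_s` on nodes. -/
def NodeLt (s : Fin (l + 1) → ℤ) (γ γ' : Node l) : Prop :=
  content s γ < content s γ' ∨ (content s γ = content s γ' ∧ γ'.comp < γ.comp)

inductive Letter | A | R
  deriving DecidableEq

/-- The letter attached to a node is `A` iff the node is addable, `R` iff removable. -/
def LetterOk (Λ : MultiPartition l) (p : Node l × Letter) : Prop :=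
  (p.2 = Letter.A ↔ Addable Λ p.1) ∧ (p.2 = Letter.R ↔ Removable Λ p.1)

/-- `w` is the `i`-word of `(Λ, s)` for the residue-mod-`e` structure: the list of
addable/removable nodes of residue `i`, in increasing `≺_s`-order, with letters A/R. -/
def IsWordE (Λ : MultiPartition l) (s : Fin (l + 1) → ℤ) (e : ℕ) (i : ℤ)
    (w : List (Node l × Letter)) : Prop :=
  w.Pairwise (fun p q => NodeLt s p.1 q.1) ∧
  (∀ γ : Node l, (∃ x, (γ, x) ∈ w) ↔
      ((Addable Λ γ ∨ Removable Λ γ) ∧ content s γ % (e : ℤ) = i)) ∧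
  ∀ p ∈ w, LetterOk Λ p

/-- `w` is the `j`-word of `(Λ, s)` for the `e = ∞` structure: the list of
addable/removable nodes of content `j`, in increasing `≺_s`-order, with letters A/R. -/
def IsWordInf (Λ : MultiPartition l) (s : Fin (l + 1) → ℤ) (j : ℤ)
    (w : List (Node l × Letter)) : Prop :=
  w.Pairwise (fun p q => NodeLt s p.1 q.1) ∧
  (∀ γ : Node l, (∃ x, (γ, x) ∈ w) ↔
      ((Addable Λ γ ∨ Removable Λ γ) ∧ content s γ = j)) ∧
  ∀ p ∈ w, LetterOk Λ p

/-- Recursive cancellation of all factors `RA` in a word (of nodes with letters). -/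
def reduceW : List (Node l × Letter) → List (Node l × Letter)
  | [] => []
  | p :: ps =>
    match reduceW ps with
    | [] => [p]
    | q :: qs => if p.2 = Letter.R ∧ q.2 = Letter.A then qs else p :: q :: qs

/-- `γ` is the node encoded by the rightmost `A` of the reduced word of `w`. -/
def GoodAddableWord (w : List (Node l × Letter)) (γ : Node l) : Prop :=
  ∃ u v, reduceW w = u ++ (γ, Letter.A) :: v ∧ ∀ p ∈ v, p.2 = Letter.R

/-- `γ` is the node encoded by the leftmost `R` of the reduced word of `w`. -/
def GoodRemovableWord (w : List (Node l × Letter)) (γ : Node l) : Prop :=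
  ∃ u v, reduceW w = u ++ (γ, Letter.R) :: v ∧ ∀ p ∈ u, p.2 = Letter.A

/-- `γ` is the good addable `i`-node of `(Λ, s)` for the residue-mod-`e` structure. -/
def GoodAddable (Λ : MultiPartition l) (s : Fin (l + 1) → ℤ) (e : ℕ) (i : ℤ)
    (γ : Node l) : Prop :=
  ∃ w, IsWordE Λ s e i w ∧ GoodAddableWord w γ

/-- `γ` is the good removable `i`-node of `(Λ, s)` for the residue-mod-`e` structure. -/
def GoodRemovable (Λ : MultiPartition l) (s : Fin (l + 1) → ℤ) (e : ℕ) (i : ℤ)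
    (γ : Node l) : Prop :=
  ∃ w, IsWordE Λ s e i w ∧ GoodRemovableWord w γ

/-- `γ` is the good addable `j`-node of `(Λ, s)` for the `e = ∞` structure. -/
def GoodAddableInf (Λ : MultiPartition l) (s : Fin (l + 1) → ℤ) (j : ℤ)
    (γ : Node l) : Prop :=
  ∃ w, IsWordInf Λ s j w ∧ GoodAddableWord w γ

/-- `Λ'` is obtained from `Λ` by adding the node `γ`. -/
def AddNode (Λ Λ' : MultiPartition l) (γ : Node l) : Prop :=
  (Λ' γ.comp).part γ.row = (Λ γ.comp).part γ.row + 1 ∧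
  (∀ a : ℕ, a ≠ γ.row → (Λ' γ.comp).part a = (Λ γ.comp).part a) ∧
  ∀ c, c ≠ γ.comp → Λ' c = Λ c

/-- `s ∈ S_e`: `0 ≤ s_c − s_{c'} < e` whenever `c' < c`. -/
def InSe (e : ℕ) (s : Fin (l + 1) → ℤ) : Prop :=
  ∀ c' c : Fin (l + 1), c' < c → 0 ≤ s c - s c' ∧ s c - s c' < (e : ℤ)

/-- `s ∈ D_e`: `0 ≤ s_1 ≤ … ≤ s_l < e`. -/
def InDe (e : ℕ) (s : Fin (l + 1) → ℤ) : Prop :=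
  (∀ c, 0 ≤ s c ∧ s c < (e : ℤ)) ∧ Monotone s

/-- The rotation `c ↦ c + 1` of components. -/
def rho (l : ℕ) : Equiv.Perm (Fin (l + 1)) := finRotate (l + 1)

/-- The cyclage on multicharges: `ξ(s) = (s_l − e, s_1, …, s_{l−1})`. -/
def xiCharge (e : ℕ) (s : Fin (l + 1) → ℤ) : Fin (l + 1) → ℤ :=
  fun c => s ((rho l).symm c) - if c = 0 then (e : ℤ) else 0

/-- The cyclage on multipartitions: `ξ(λ) = (λ^l, λ^1, …, λ^{l−1})`. -/
def xiMP (Λ : MultiPartition l) : MultiPartition l := fun c => Λ ((rho l).symm c)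

/-- The corresponding bijection on nodes: `(a,b,c) ↦ (a,b,c+1)` cyclically. -/
def xiNode (γ : Node l) : Node l := ⟨γ.row, γ.col, rho l γ.comp⟩

/-- The component preceding `c` (cyclically). -/
def prevComp {l : ℕ} (c : Fin (l + 1)) : Fin (l + 1) := (rho l).symm c

/-- `(Λ, s)` is cylindric. -/
def Cylindric (e : ℕ) (s : Fin (l + 1) → ℤ) (Λ : MultiPartition l) : Prop :=
  (∀ c : Fin l, ∀ a : ℕ, 1 ≤ a →
      (Λ c.succ).part (a + (s c.succ - s c.castSucc).toNat) ≤ (Λ c.castSucc).part a) ∧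
  ∀ a : ℕ, 1 ≤ a →
      (Λ 0).part (a + ((e : ℤ) + s 0 - s (Fin.last l)).toNat) ≤ (Λ (Fin.last l)).part a

/-- `γ` is the rightmost node of a part of `Λ` of size `α`. -/
def RightmostAt (Λ : MultiPartition l) (α : ℕ) (γ : Node l) : Prop :=
  1 ≤ γ.row ∧ γ.col = α ∧ (Λ γ.comp).part γ.row = α

/-- The residues of the rightmost nodes of the parts of size `α` cover `{0,…,e−1}`. -/
def Covers (e : ℕ) (s : Fin (l + 1) → ℤ) (Λ : MultiPartition l) (α : ℕ) : Prop :=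
  ∀ r : ℤ, 0 ≤ r → r < (e : ℤ) →
    ∃ γ : Node l, RightmostAt Λ α γ ∧ content s γ % (e : ℤ) = r

/-- `(Λ, s)` is FLOTW. -/
def FLOTW (e : ℕ) (s : Fin (l + 1) → ℤ) (Λ : MultiPartition l) : Prop :=
  Cylindric e s Λ ∧ ∀ α : ℕ, 1 ≤ α → ¬ Covers e s Λ α

/-- `P 0, …, P (e−1)` is the first pseudoperiod of `(Λ, s)`, of width `α`. -/
def IsFirstPseudoperiod (e : ℕ) (s : Fin (l + 1) → ℤ) (Λ : MultiPartition l)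
    (α : ℕ) (P : ℕ → Node l) : Prop :=
  1 ≤ α ∧ Covers e s Λ α ∧ (∀ β : ℕ, α < β → ¬ Covers e s Λ β) ∧
  (∀ i, i < e → RightmostAt Λ α (P i)) ∧
  (∀ γ, RightmostAt Λ α γ → content s γ ≤ content s (P 0)) ∧
  (∀ γ, RightmostAt Λ α γ → content s γ = content s (P 0) → (P 0).comp ≤ γ.comp) ∧
  ∀ i : ℕ, i + 1 < e →
    content s (P (i + 1)) < content s (P i) ∧
    (∀ γ, RightmostAt Λ α γ → content s γ < content s (P i) →
        content s γ ≤ content s (P (i + 1))) ∧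
    ∀ γ, RightmostAt Λ α γ → content s γ = content s (P (i + 1)) →
        (P (i + 1)).comp ≤ γ.comp

/-- `γ` is one of the nodes of the pseudoperiod `P` (of length `e`). -/
def InPseudo (e : ℕ) (P : ℕ → Node l) (γ : Node l) : Prop := ∃ i, i < e ∧ P i = γ

/-- The number of parts of `π` equal to `v`. -/
noncomputable def countParts (π : Partition) (v : ℕ) : ℕ :=
  Nat.card {a : ℕ // 1 ≤ a ∧ π.part a = v}

/-- `N^{>α}_c`: the number of parts of `Λ^c` greater than `α`. -/
noncomputable def NgtA (Λ : MultiPartition l) (α : ℕ) (c : Fin (l + 1)) : ℕ :=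
  Nat.card {a : ℕ // 1 ≤ a ∧ α < (Λ c).part a}

/-- `N^α_c`: the number of parts of `Λ^c` (equal to `α`) whose rightmost node is in `P`. -/
noncomputable def NalP (e : ℕ) (P : ℕ → Node l) (c : Fin (l + 1)) : ℕ :=
  Nat.card {i : ℕ // i < e ∧ (P i).comp = c}

/-- The number of rows of component `c` above row `r` whose rightmost node is in `P`. -/
noncomputable def PAbove (e : ℕ) (P : ℕ → Node l) (c : Fin (l + 1)) (r : ℕ) : ℕ :=
  Nat.card {i : ℕ // i < e ∧ (P i).comp = c ∧ (P i).row < r}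

/-- `μ = ψ(Λ)`: for each component `C`, `μ^C` consists of the parts of `Λ^C` smaller
than `α`, the parts of `Λ^C` equal to `α` whose rightmost node is not in `P`, and the
parts of `Λ^{C−1}` (cyclically) greater than `α`; specified via part multiplicities. -/
def IsPsi (e : ℕ) (P : ℕ → Node l) (α : ℕ) (Λ μ : MultiPartition l) : Prop :=
  ∀ C : Fin (l + 1), ∀ v : ℕ, 1 ≤ v →
    countParts (μ C) v =
      if v < α then countParts (Λ C) v
      else if v = α then countParts (Λ C) α - NalP e P C
      else countParts (Λ (prevComp C)) v

/-- The canonical association between nodes of `Λ` (outside the rows of `P`) and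
nodes of `ψ(Λ)`: boxes of parts `> α` keep their row and move one component up
(cyclically), boxes of kept parts `≤ α` stay in their component, their row being
shifted by the number of rows removed above minus the number of rows inserted above. -/
def CanonAssoc (e : ℕ) (Λ : MultiPartition l) (α : ℕ) (P : ℕ → Node l)
    (γ Γ : Node l) : Prop :=
  Γ.col = γ.col ∧
  ( (α < (Λ γ.comp).part γ.row ∧ Γ.comp = rho l γ.comp ∧ Γ.row = γ.row)
  ∨ ((Λ γ.comp).part γ.row ≤ α ∧
      (∀ i, i < e → ¬ ((P i).comp = γ.comp ∧ (P i).row = γ.row)) ∧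
      Γ.comp = γ.comp ∧
      Γ.row + NgtA Λ α γ.comp + PAbove e P γ.comp γ.row
        = γ.row + NgtA Λ α (prevComp γ.comp)) )

/-- The entry of the `s`-symbol of `Λ` of size `p` in row `c` and column `k`
(`1 ≤ k ≤ p + s_c`): `b^c_a = λ^c_a − a + p + s_c` with `a = p + s_c − k + 1`. -/
def symbolEntry (s : Fin (l + 1) → ℤ) (Λ : MultiPartition l) (p : ℤ)
    (c : Fin (l + 1)) (k : ℕ) : ℤ :=
  ((Λ c).part (p + s c - (k : ℤ) + 1).toNat : ℤ) - (p + s c - (k : ℤ) + 1) + p + s c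

/-- `p` is an admissible size for the `s`-symbol of `Λ`:
`p ≥ 1 − s_c + h(λ^c)` for all `c`. -/
def SizeOK (s : Fin (l + 1) → ℤ) (Λ : MultiPartition l) (p : ℤ) : Prop :=
  ∀ c, 1 ≤ p + s c ∧ ∀ a : ℕ, p + s c ≤ (a : ℤ) → (Λ c).part a = 0

/-- The `s`-symbol of `Λ` of size `p` is semistandard: `s` is non-decreasing, the
entries in each column are non-decreasing (read from the row with the larger index
down to the row with the smaller one), and the entries in each row are increasing. -/
def SemistandardAt (s : Fin (l + 1) → ℤ) (Λ : MultiPartition l) (p : ℤ) : Prop :=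
  Monotone s ∧
  (∀ c c' : Fin (l + 1), c < c' → ∀ k : ℕ, 1 ≤ k → (k : ℤ) ≤ p + s c →
      symbolEntry s Λ p c' k ≤ symbolEntry s Λ p c k) ∧
  ∀ c, ∀ k : ℕ, 1 ≤ k → (k : ℤ) + 1 ≤ p + s c →
      symbolEntry s Λ p c k < symbolEntry s Λ p c (k + 1)

/-- The `s`-symbol of `Λ` is semistandard (for every admissible size). -/
def Semistandard (s : Fin (l + 1) → ℤ) (Λ : MultiPartition l) : Prop :=
  ∀ p : ℤ, SizeOK s Λ p → SemistandardAt s Λ p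

/-- The index of the column of the symbol of size `p` containing the entry
corresponding to the node `γ`. -/
def colOf (s : Fin (l + 1) → ℤ) (p : ℤ) (γ : Node l) : ℤ :=
  p + s γ.comp - (γ.row : ℤ) + 1


/-- In a reduced word, every letter `A` precedes every letter `R`. -/
theorem pairwise_reduceW (w : List (Node l × Letter)) :
    (reduceW w).Pairwise (fun p q => p.2 = Letter.R → q.2 = Letter.R) := by
  induction w with
  | nil => simp [reduceW]
  | cons p ps ih =>
    rw [reduceW]
    cases h : reduceW ps with
    | nil => simp
    | cons q qs =>
      rw [h] at ih
      dsimp only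
      split_ifs with hc
      · exact (List.pairwise_cons.1 ih).2
      · refine List.pairwise_cons.2 ⟨fun r hr hp => ?_, ih⟩
        have hq : q.2 = Letter.R := by
          cases hq : q.2 with
          | A => exact absurd ⟨hp, hq⟩ hc
          | R => rfl
        rcases List.mem_cons.1 hr with rfl | hr
        · exact hq
        · exact (List.pairwise_cons.1 ih).1 r hr hq

/-- A letter surviving the reduction of `w` splits `w` into two words that reduce separately. -/
theorem exists_split_of_reduceW_eq {w u v : List (Node l × Letter)} {q : Node l × Letter}
    (h : reduceW w = u ++ q :: v) :
    ∃ x y, w = x ++ q :: y ∧ reduceW x = u ∧ reduceW y = v := by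
  induction w generalizing u with
  | nil => simp [reduceW] at h
  | cons p ps ih =>
    rw [reduceW] at h
    cases hr : reduceW ps with
    | nil =>
      simp only [hr] at h
      cases u with
      | nil =>
        obtain ⟨rfl, rfl⟩ := List.cons.inj h
        exact ⟨[], ps, rfl, rfl, hr⟩
      | cons a u => simp at h
    | cons a as =>
      simp only [hr] at h
      split_ifs at h with hc
      · obtain ⟨x, y, rfl, hx, hy⟩ := ih (u := a :: u) (by rw [hr, h]; rfl)
        exact ⟨p :: x, y, rfl, by simp [reduceW, hx, hc], hy⟩
      · cases u with
        | nil =>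
          obtain ⟨rfl, rfl⟩ := List.cons.inj h
          exact ⟨[], ps, rfl, rfl, hr⟩
        | cons b u =>
          obtain ⟨rfl, h'⟩ := List.cons.inj h
          obtain ⟨x, y, rfl, hx, hy⟩ := ih (hr.trans h')
          refine ⟨p :: x, y, rfl, ?_, hy⟩
          rw [reduceW, hx]
          cases u with
          | nil => rfl
          | cons c u =>
            obtain ⟨rfl, -⟩ := List.cons.inj h'
            simp only [if_neg hc]

theorem reduceW_forall_A_of_cons {p : Node l × Letter} {w : List (Node l × Letter)}
    (h : ∀ q ∈ reduceW (p :: w), q.2 = Letter.A) : ∀ q ∈ reduceW w, q.2 = Letter.A := by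
  rw [reduceW] at h
  cases hr : reduceW w with
  | nil => simp
  | cons a as =>
    simp only [hr] at h
    split_ifs at h with hc
    · exact List.forall_mem_cons.2 ⟨hc.2, h⟩
    · exact (List.forall_mem_cons.1 h).2

theorem reduceW_forall_A_of_suffix {x w : List (Node l × Letter)} (hx : x <:+ w)
    (h : ∀ q ∈ reduceW w, q.2 = Letter.A) : ∀ q ∈ reduceW x, q.2 = Letter.A := by
  obtain ⟨t, rfl⟩ := hx
  induction t with
  | nil => exact h
  | cons p t ih => exact ih (reduceW_forall_A_of_cons h)

theorem reduceW_append_cons {x y : List (Node l × Letter)} {q : Node l × Letter}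
    (hq : q.2 = Letter.A) (hx : ∀ p ∈ reduceW x, p.2 = Letter.A) :
    reduceW (x ++ q :: y) = reduceW x ++ q :: reduceW y := by
  induction x with
  | nil =>
    rw [List.nil_append, reduceW]
    cases hr : reduceW y <;> simp [reduceW, hr, hq]
  | cons p x ih =>
    rw [List.cons_append, reduceW, ih (reduceW_forall_A_of_cons hx)]
    rw [reduceW] at hx ⊢
    cases hr : reduceW x with
    | nil =>
      have hp : p.2 = Letter.A := by simpa [hr] using hx
      simp [hp]
    | cons a as =>
      simp only [List.cons_append]
      split_ifs <;> rfl

/-- The number of letters `A` in the reduced word. -/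
def countA (w : List (Node l × Letter)) : ℕ :=
  (reduceW w).countP (fun p => p.2 = Letter.A)

theorem countA_eq_zero_iff {w : List (Node l × Letter)} :
    countA w = 0 ↔ ∀ p ∈ reduceW w, p.2 = Letter.R := by
  rw [countA, List.countP_eq_zero]
  refine forall₂_congr fun p _ => ?_
  cases p.2 <;> simp

theorem countA_cons (p : Node l × Letter) (w : List (Node l × Letter)) :
    countA (p :: w) = if p.2 = Letter.A then countA w + 1 else countA w - 1 := by
  have hw := pairwise_reduceW w
  rw [countA, countA, reduceW]
  cases hr : reduceW w with
  | nil => cases hp : p.2 <;> simp [hp]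
  | cons a as =>
    rw [hr] at hw
    cases hp : p.2 with
    | A => simp [hp]
    | R =>
      cases ha : a.2 with
      | A => simp [ha]
      | R =>
        have has : as.countP (fun p => p.2 = Letter.A) = 0 :=
          List.countP_eq_zero.2 fun r hrs => by simp [(List.pairwise_cons.1 hw).1 r hrs ha]
        simp [hp, ha, has]

theorem countA_le_countA_append (x y : List (Node l × Letter)) :
    countA x ≤ countA (x ++ y) := by
  induction x with
  | nil => simp [countA, reduceW]
  | cons p x ih =>
    rw [List.cons_append, countA_cons, countA_cons]
    split_ifs <;> omega

theorem reduceW_forall_R_of_prefix {y w : List (Node l × Letter)} (hy : y <+: w)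
    (h : ∀ q ∈ reduceW w, q.2 = Letter.R) : ∀ q ∈ reduceW y, q.2 = Letter.R := by
  obtain ⟨t, rfl⟩ := hy
  have := countA_le_countA_append y t
  rw [countA_eq_zero_iff.2 h] at this
  exact countA_eq_zero_iff.1 (Nat.le_zero.1 this)

theorem goodAddableWord_iff {w : List (Node l × Letter)} {γ : Node l} :
    GoodAddableWord w γ ↔ ∃ x y, w = x ++ (γ, Letter.A) :: y ∧
      (∀ p ∈ reduceW x, p.2 = Letter.A) ∧ ∀ p ∈ reduceW y, p.2 = Letter.R := by
  constructor
  · rintro ⟨u, v, h, hv⟩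
    have hw := pairwise_reduceW w
    rw [h, List.pairwise_append] at hw
    obtain ⟨x, y, rfl, rfl, rfl⟩ := exists_split_of_reduceW_eq h
    refine ⟨x, y, rfl, fun p hp => ?_, hv⟩
    cases hpl : p.2 with
    | A => rfl
    | R => exact absurd (hw.2.2 p hp _ List.mem_cons_self hpl) (by simp)
  · rintro ⟨x, y, rfl, hx, hy⟩
    exact ⟨_, _, reduceW_append_cons rfl hx, hy⟩

theorem filter_suffix_of_pairwise_le {α : Type*} {f : α → ℤ} {j : ℤ} {x : List α}
    (hx : x.Pairwise (fun p q => f p ≤ f q)) (hj : ∀ p ∈ x, f p ≤ j) :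
    x.filter (fun p => f p = j) <:+ x := by
  induction x with
  | nil => simp
  | cons p x ih =>
    rw [List.pairwise_cons] at hx
    rw [List.forall_mem_cons] at hj
    by_cases hp : f p = j
    · have : (p :: x).filter (fun p => f p = j) = p :: x := by
        rw [List.filter_eq_self, List.forall_mem_cons]
        exact ⟨by simpa using hp, fun q hq => by
          simpa using le_antisymm (hj.2 q hq) (hp ▸ hx.1 q hq)⟩
      rw [this]
    · rw [List.filter_cons_of_neg (by simpa using hp)]
      exact (ih hx.2 hj.2).trans (List.suffix_cons p x)

theorem filter_prefix_of_pairwise_le {α : Type*} {f : α → ℤ} {j : ℤ} {y : List α}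
    (hy : y.Pairwise (fun p q => f p ≤ f q)) (hj : ∀ p ∈ y, j ≤ f p) :
    y.filter (fun p => f p = j) <+: y := by
  induction y with
  | nil => simp
  | cons p y ih =>
    rw [List.pairwise_cons] at hy
    rw [List.forall_mem_cons] at hj
    by_cases hp : f p = j
    · rw [List.filter_cons_of_pos (by simpa using hp)]
      exact List.cons_prefix_cons.2 ⟨rfl, ih hy.2 hj.2⟩
    · have : (p :: y).filter (fun p => f p = j) = [] := by
        rw [List.filter_eq_nil_iff, List.forall_mem_cons]
        refine ⟨by simpa using hp, fun q hq => ?_⟩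
        have := hy.1 q hq
        have := hj.1
        simp only [decide_eq_true_eq]
        omega
      rw [this]
      exact List.nil_prefix

theorem NodeLt.content_le {s : Fin (l + 1) → ℤ} {γ γ' : Node l} (h : NodeLt s γ γ') :
    content s γ ≤ content s γ' :=
  h.elim le_of_lt fun h => h.1.le

theorem IsWordE.isWordInf_filter {Λ : MultiPartition l} {s : Fin (l + 1) → ℤ} {e : ℕ} {i j : ℤ}
    {w : List (Node l × Letter)} (hw : IsWordE Λ s e i w) (hj : j % (e : ℤ) = i) :
    IsWordInf Λ s j (w.filter (fun p => content s p.1 = j)) := by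
  refine ⟨hw.1.filter _, fun γ => ?_, fun p hp => hw.2.2 p (List.mem_of_mem_filter hp)⟩
  simp only [List.mem_filter, decide_eq_true_eq, exists_and_right, hw.2.1 γ]
  constructor
  · rintro ⟨⟨h, -⟩, hc⟩
    exact ⟨h, hc⟩
  · rintro ⟨h, rfl⟩
    exact ⟨⟨h, hj⟩, rfl⟩

/-!
STATEMENT 5: if γ is the good addable i-node of λ for the residue-mod-e crystal
structure, then γ is also the good addable j-node of λ for the e = ∞ structure,
where j = cont(γ).
-/
theorem good_addable_node_e_is_good_addable_node_infinity
    (l e : ℕ) (he : 2 ≤ e) (s : Fin (l + 1) → ℤ) (Λ : MultiPartition l)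
    (i : ℕ) (hi : i < e) (γ : Node l)
    (hgood : GoodAddable Λ s e (i : ℤ) γ) :
    GoodAddableInf Λ s (content s γ) γ := by
  obtain ⟨w, hw, hγ⟩ := hgood
  obtain ⟨x, y, rfl, hx, hy⟩ := goodAddableWord_iff.1 hγ
  have hres : content s γ % (e : ℤ) = i := ((hw.2.1 γ).1 ⟨Letter.A, by simp⟩).2
  have hsort := hw.1.imp (S := fun p q : Node l × Letter => content s p.1 ≤ content s q.1)
    NodeLt.content_le
  rw [List.pairwise_append, List.pairwise_cons] at hsort
  obtain ⟨hsx, ⟨hγy, hsy⟩, hxγ⟩ := hsort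
  refine ⟨_, hw.isWordInf_filter hres, goodAddableWord_iff.2 ⟨_, _, ?_,
    reduceW_forall_A_of_suffix
      (filter_suffix_of_pairwise_le hsx fun p hp => hxγ p hp _ List.mem_cons_self) hx,
    reduceW_forall_R_of_prefix (filter_prefix_of_pairwise_le hsy hγy) hy⟩⟩
  rw [List.filter_append, List.filter_cons_of_pos (by simp)]

end FockCrystal
end

section
/- Fix integers l ≥ 1 and e ≥ 2. Let λ be an l-partition charged by s ∈ ℤ^l and μ an l-partition charged by r ∈ ℤ^l. If the reduced j-words for the e = ∞ structure agree, ŵ_j^∞(λ,s) = ŵ_j^∞(μ,r) for every j ∈ ℤ (as words in the letters A, R), then the reduced i-words for the residue-mod-e structure agree: ŵ_i^e(λ,s) = ŵ_i^e(μ,r) for every i ∈ {0,…,e−1}. -/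
namespace FockCrystal

variable {l : ℕ}

theorem nodeLt_irrefl (s : Fin (l + 1) → ℤ) (γ : Node l) : ¬ NodeLt s γ γ := by
  simp [NodeLt]

theorem NodeLt.asymm {s : Fin (l + 1) → ℤ} {γ γ' : Node l} (h : NodeLt s γ γ') :
    ¬ NodeLt s γ' γ := by
  rintro (h' | ⟨h', hc'⟩) <;> rcases h with h | ⟨h, hc⟩
  · omega
  · omega
  · omega
  · exact absurd hc hc'.asymm

theorem nodup_of_pairwise_nodeLt {s : Fin (l + 1) → ℤ} {w : List (Node l × Letter)}
    (h : w.Pairwise fun p q => NodeLt s p.1 q.1) : w.Nodup :=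
  h.imp (S := (· ≠ ·)) fun {p _} hpq heq => nodeLt_irrefl s p.1 (by rwa [← heq] at hpq)

/-- Two words in increasing order with the same entries are equal. -/
theorem eq_of_pairwise_nodeLt {s : Fin (l + 1) → ℤ} {w w' : List (Node l × Letter)}
    (h : w.Pairwise fun p q => NodeLt s p.1 q.1) (h' : w'.Pairwise fun p q => NodeLt s p.1 q.1)
    (hmem : ∀ p, p ∈ w ↔ p ∈ w') : w = w' :=
  List.Perm.eq_of_pairwise (fun _ _ _ _ hab hba => absurd hba hab.asymm) h h'
    ((List.perm_ext_iff_of_nodup (nodup_of_pairwise_nodeLt h) (nodup_of_pairwise_nodeLt h')).2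
      hmem)

/-- A node carries at most one letter. -/
theorem LetterOk.letter_unique {Λ : MultiPartition l} {γ : Node l} {x y : Letter}
    (hx : LetterOk Λ (γ, x)) (hy : LetterOk Λ (γ, y)) : x = y := by
  cases x
  · exact (hy.1.2 (hx.1.1 rfl)).symm
  · exact (hy.2.2 (hx.2.1 rfl)).symm

theorem IsWordE.mem_iff {Λ : MultiPartition l} {s : Fin (l + 1) → ℤ} {e : ℕ} {i : ℤ}
    {w : List (Node l × Letter)} (hw : IsWordE Λ s e i w) (p : Node l × Letter) :
    p ∈ w ↔ (Addable Λ p.1 ∨ Removable Λ p.1) ∧ content s p.1 % (e : ℤ) = i ∧ LetterOk Λ p := by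
  refine ⟨fun hp => ?_, fun ⟨hnode, hres, hok⟩ => ?_⟩
  · obtain ⟨hnode, hres⟩ := (hw.2.1 p.1).1 ⟨p.2, hp⟩
    exact ⟨hnode, hres, hw.2.2 p hp⟩
  · obtain ⟨y, hy⟩ := (hw.2.1 p.1).2 ⟨hnode, hres⟩
    rwa [(hw.2.2 _ hy).letter_unique hok] at hy

theorem IsWordInf.mem_iff {Λ : MultiPartition l} {s : Fin (l + 1) → ℤ} {j : ℤ}
    {w : List (Node l × Letter)} (hw : IsWordInf Λ s j w) (p : Node l × Letter) :
    p ∈ w ↔ (Addable Λ p.1 ∨ Removable Λ p.1) ∧ content s p.1 = j ∧ LetterOk Λ p := by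
  refine ⟨fun hp => ?_, fun ⟨hnode, hcont, hok⟩ => ?_⟩
  · obtain ⟨hnode, hcont⟩ := (hw.2.1 p.1).1 ⟨p.2, hp⟩
    exact ⟨hnode, hcont, hw.2.2 p hp⟩
  · obtain ⟨y, hy⟩ := (hw.2.1 p.1).2 ⟨hnode, hcont⟩
    rwa [(hw.2.2 _ hy).letter_unique hok] at hy

/-- The `i`-word modulo `e` is the concatenation of the `j`-words over any increasing list of
contents `j ≡ i` that contains all the contents occurring in it. -/
theorem IsWordE.eq_flatMap {Λ : MultiPartition l} {s : Fin (l + 1) → ℤ} {e : ℕ} {i : ℤ}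
    {w : List (Node l × Letter)} {W : ℤ → List (Node l × Letter)}
    (hw : IsWordE Λ s e i w) (hW : ∀ j, IsWordInf Λ s j (W j)) {J : List ℤ}
    (hJ : J.Pairwise (· < ·)) (hres : ∀ j ∈ J, j % (e : ℤ) = i)
    (hcov : ∀ p ∈ w, content s p.1 ∈ J) : w = J.flatMap W := by
  refine eq_of_pairwise_nodeLt hw.1 (List.pairwise_flatMap.2 ⟨fun j _ => (hW j).1, ?_⟩) ?_
  · refine hJ.imp fun {j k} hjk p hp q hq => Or.inl ?_
    rw [(((hW j).mem_iff p).1 hp).2.1, (((hW k).mem_iff q).1 hq).2.1]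
    exact hjk
  · intro p
    rw [List.mem_flatMap]
    constructor
    · intro hp
      obtain ⟨hnode, -, hok⟩ := (hw.mem_iff p).1 hp
      exact ⟨_, hcov p hp, ((hW _).mem_iff p).2 ⟨hnode, rfl, hok⟩⟩
    · rintro ⟨j, hj, hp⟩
      obtain ⟨hnode, hcont, hok⟩ := ((hW j).mem_iff p).1 hp
      exact (hw.mem_iff p).2 ⟨hnode, hcont ▸ hres j hj, hok⟩

/-- Prepend a letter to a reduced word, cancelling a factor `RA`. -/
def consReduce : Letter → List Letter → List Letter
  | .R, .A :: v => v
  | x, v => x :: v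

theorem map_snd_reduceW (w : List (Node l × Letter)) :
    (reduceW w).map Prod.snd = (w.map Prod.snd).foldr consReduce [] := by
  induction w with
  | nil => rfl
  | cons p ps ih =>
    obtain ⟨γ, x⟩ := p
    rw [List.map_cons, List.foldr_cons, ← ih, reduceW]
    rcases reduceW ps with _ | ⟨⟨δ, y⟩, qs⟩
    · cases x <;> rfl
    · cases x <;> cases y <;> rfl

theorem foldr_consReduce_consReduce (x : Letter) (u v : List Letter) :
    (consReduce x u).foldr consReduce v = consReduce x (u.foldr consReduce v) := by
  rcases u with _ | ⟨y, u⟩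
  · cases x <;> rfl
  · cases x <;> cases y <;> rfl

/-- Reducing a left factor first does not change the reduced word. -/
theorem foldr_consReduce_foldr (u v : List Letter) :
    (u.foldr consReduce []).foldr consReduce v = u.foldr consReduce v := by
  induction u with
  | nil => rfl
  | cons x u ih => rw [List.foldr_cons, foldr_consReduce_consReduce, ih, List.foldr_cons]

/-- The letters of a reduced concatenation depend only on those of the reduced factors. -/
theorem map_snd_reduceW_flatMap_congr {W W' : ℤ → List (Node l × Letter)}
    (h : ∀ j, (reduceW (W j)).map Prod.snd = (reduceW (W' j)).map Prod.snd) (J : List ℤ) :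
    (reduceW (J.flatMap W)).map Prod.snd = (reduceW (J.flatMap W')).map Prod.snd := by
  simp only [map_snd_reduceW] at h ⊢
  induction J with
  | nil => rfl
  | cons j J ih =>
    rw [List.flatMap_cons, List.flatMap_cons, List.map_append, List.map_append,
      List.foldr_append, List.foldr_append, ih, ← foldr_consReduce_foldr, h j,
      foldr_consReduce_foldr]

/-!
STATEMENT 6: if the reduced j-words (for the e = ∞ structure) of (λ, s) and (μ, r)
agree for every j ∈ ℤ (as words in the letters A, R), then the reduced i-words for
the residue-mod-e structure agree for every i ∈ {0,…,e−1}.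
-/
theorem equal_reduced_infinite_words_give_equal_reduced_e_words
    (l e : ℕ) (he : 2 ≤ e)
    (Λ μ : MultiPartition l) (s r : Fin (l + 1) → ℤ)
    (Wl Wm : ℤ → List (Node l × Letter))
    (hWl : ∀ j : ℤ, IsWordInf Λ s j (Wl j))
    (hWm : ∀ j : ℤ, IsWordInf μ r j (Wm j))
    (hred : ∀ j : ℤ, (reduceW (Wl j)).map Prod.snd = (reduceW (Wm j)).map Prod.snd) :
    ∀ i : ℕ, i < e → ∀ wl wm : List (Node l × Letter),
      IsWordE Λ s e (i : ℤ) wl → IsWordE μ r e (i : ℤ) wm →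
      (reduceW wl).map Prod.snd = (reduceW wm).map Prod.snd := by
  intro i _ wl wm hwl hwm
  let F : Finset ℤ := (wl.map fun p => content s p.1).toFinset ∪
    (wm.map fun p => content r p.1).toFinset
  have hJ : F.sort.Pairwise (· < ·) := F.sortedLT_sort.pairwise
  have hres : ∀ j ∈ F.sort, j % (e : ℤ) = i := by
    intro j hj
    rw [Finset.mem_sort, Finset.mem_union, List.mem_toFinset, List.mem_toFinset,
      List.mem_map, List.mem_map] at hj
    rcases hj with ⟨p, hp, rfl⟩ | ⟨p, hp, rfl⟩
    · exact ((hwl.mem_iff p).1 hp).2.1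
    · exact ((hwm.mem_iff p).1 hp).2.1
  have hcovl : ∀ p ∈ wl, content s p.1 ∈ F.sort := fun p hp =>
    (Finset.mem_sort _).2 <| Finset.mem_union_left _ <|
      List.mem_toFinset.2 <| List.mem_map.2 ⟨p, hp, rfl⟩
  have hcovm : ∀ p ∈ wm, content r p.1 ∈ F.sort := fun p hp =>
    (Finset.mem_sort _).2 <| Finset.mem_union_right _ <|
      List.mem_toFinset.2 <| List.mem_map.2 ⟨p, hp, rfl⟩
  rw [hwl.eq_flatMap hWl hJ hres hcovl, hwm.eq_flatMap hWm hJ hres hcovm]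
  exact map_snd_reduceW_flatMap_congr hred _

end FockCrystal
end

section
/- Fix integers l ≥ 1 and e ≥ 2, let s ∈ ℤ^l and let λ be an l-partition. Then the following are equivalent: (i) s ∈ S_e and (λ,s) is cylindric, i.e. λ^c_a ≥ λ^{c+1}_{a + s_{c+1} − s_c} for all 1 ≤ c ≤ l−1 and a ≥ 1, and λ^l_a ≥ λ^1_{a + e + s_1 − s_l} for all a ≥ 1; (ii) s ∈ S_e, the s-symbol B_s(λ) is semistandard, and the ξ(s)-symbol B_{ξ(s)}(ξ(λ)) of the cycled pair is semistandard, where ξ(s) = (s_l − e, s_1, …, s_{l−1}) and ξ(λ) = (λ^l, λ^1, …, λ^{l−1}). -/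
namespace FockCrystal

variable {l : ℕ}

/-- The cylindric inequality between two charged partitions: the charges satisfy `x.1 ≤ y.1` and
`y.2` shifted by `y.1 - x.1` rows is contained in `x.2`. -/
def ChargedDominates (x y : ℤ × Partition) : Prop :=
  x.1 ≤ y.1 ∧ ∀ a b : ℕ, 1 ≤ a → (b : ℤ) + x.1 = a + y.1 → y.2.part b ≤ x.2.part a

instance isTrans_chargedDominates : IsTrans (ℤ × Partition) ChargedDominates where
  trans := by
    rintro x y z ⟨hxy, hxy'⟩ ⟨hyz, hyz'⟩
    refine ⟨hxy.trans hyz, fun a b ha hab => ?_⟩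
    have hm : ((a + (y.1 - x.1).toNat : ℕ) : ℤ) + x.1 = a + y.1 := by omega
    exact (hyz' _ b (by omega) (by omega)).trans (hxy' a _ ha hm)

theorem chargedDominates_iff (x y : ℤ × Partition) :
    ChargedDominates x y ↔
      x.1 ≤ y.1 ∧ ∀ a : ℕ, 1 ≤ a → y.2.part (a + (y.1 - x.1).toNat) ≤ x.2.part a := by
  refine and_congr_right fun h => ⟨fun H a ha => H a _ ha (by omega), fun H a b ha hab => ?_⟩
  obtain rfl : b = a + (y.1 - x.1).toNat := by omega
  exact H a ha

theorem Partition.part_le_part (π : Partition) {a b : ℕ} (ha : 1 ≤ a) (hab : a ≤ b) :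
    π.part b ≤ π.part a := by
  induction b, hab using Nat.le_induction with
  | base => rfl
  | succ b hb ih => exact (π.antitone b (ha.trans hb)).trans ih

theorem exists_sizeOK (s : Fin (l + 1) → ℤ) (Λ : MultiPartition l) : ∃ p, SizeOK s Λ p := by
  choose N hN using fun c => (Λ c).eventually_zero
  refine ⟨∑ c, (|s c| + N c) + 1, fun c => ?_⟩
  have h : |s c| + N c ≤ ∑ c, (|s c| + (N c : ℤ)) :=
    Finset.single_le_sum (f := fun c => |s c| + (N c : ℤ)) (fun c _ => by positivity)
      (Finset.mem_univ c)
  have := neg_abs_le (s c)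
  exact ⟨by omega, fun a ha => hN c a (by omega)⟩

theorem symbolEntry_row_lt (s : Fin (l + 1) → ℤ) (Λ : MultiPartition l) (p : ℤ)
    (c : Fin (l + 1)) (k : ℕ) (hk : (k : ℤ) + 1 ≤ p + s c) :
    symbolEntry s Λ p c k < symbolEntry s Λ p c (k + 1) := by
  have h := (Λ c).part_le_part (a := (p + s c - ((k + 1 : ℕ) : ℤ) + 1).toNat)
    (b := (p + s c - (k : ℤ) + 1).toNat) (by omega) (by omega)
  simp only [symbolEntry]
  push_cast at h ⊢
  omega

/-- Semistandardness of the symbol amounts to the cylindric inequalities between components. -/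
theorem semistandardAt_iff {s : Fin (l + 1) → ℤ} {Λ : MultiPartition l} {p : ℤ}
    (hp : SizeOK s Λ p) :
    SemistandardAt s Λ p ↔ ∀ c c', c < c' → ChargedDominates (s c, Λ c) (s c', Λ c') := by
  constructor
  · rintro ⟨hs, hcol, -⟩ c c' hc
    refine ⟨hs hc.le, fun a b ha hab => ?_⟩
    dsimp only at hab ⊢
    by_cases hap : (a : ℤ) ≤ p + s c
    · have h := hcol c c' hc (p + s c - a + 1).toNat (by omega) (by omega)
      have ea : (p + s c - ((p + s c - a + 1).toNat : ℤ) + 1).toNat = a := by omega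
      have eb : (p + s c' - ((p + s c - a + 1).toNat : ℤ) + 1).toNat = b := by omega
      simp only [symbolEntry, ea, eb] at h
      omega
    · simp [(hp c').2 b (by omega)]
  · intro H
    refine ⟨monotone_iff_forall_lt.2 fun c c' hc => (H c c' hc).1, fun c c' hc k _ hkp => ?_,
      fun c k _ hkp => symbolEntry_row_lt s Λ p c k hkp⟩
    have hs := (H c c' hc).1
    have h := (H c c' hc).2 (p + s c - (k : ℤ) + 1).toNat (p + s c' - (k : ℤ) + 1).toNat
    dsimp only at hs h
    have h := h (by omega) (by omega)
    simp only [symbolEntry]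
    omega

theorem semistandard_iff (s : Fin (l + 1) → ℤ) (Λ : MultiPartition l) :
    Semistandard s Λ ↔ ∀ c : Fin l,
      ChargedDominates (s c.castSucc, Λ c.castSucc) (s c.succ, Λ c.succ) := by
  have hadj : (∀ c c', c < c' → ChargedDominates (s c, Λ c) (s c', Λ c')) ↔ _ :=
    Fin.liftFun_iff_succ ChargedDominates (f := fun c => (s c, Λ c))
  rw [← hadj]
  obtain ⟨p, hp⟩ := exists_sizeOK s Λ
  exact ⟨fun h => (semistandardAt_iff hp).1 (h p hp), fun h q hq => (semistandardAt_iff hq).2 h⟩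

theorem rho_symm_zero (l : ℕ) : (rho l).symm 0 = Fin.last l := by
  rw [Equiv.symm_apply_eq, rho, finRotate_last]

theorem rho_symm_succ (c : Fin l) : (rho l).symm c.succ = c.castSucc := by
  rw [Equiv.symm_apply_eq, rho, finRotate_apply, Fin.coeSucc_eq_succ]

theorem semistandard_xi_iff (e : ℕ) (s : Fin (l + 2) → ℤ) (Λ : MultiPartition (l + 1)) :
    Semistandard (xiCharge e s) (xiMP Λ) ↔
      ChargedDominates (s (Fin.last _) - e, Λ (Fin.last _)) (s 0, Λ 0) ∧
        ∀ c : Fin l, ChargedDominates (s c.castSucc.castSucc, Λ c.castSucc.castSucc)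
          (s c.castSucc.succ, Λ c.castSucc.succ) := by
  rw [semistandard_iff, Fin.forall_fin_succ]
  simp only [xiCharge, xiMP, Fin.castSucc_zero, Fin.castSucc_succ, rho_symm_zero, rho_symm_succ,
    Fin.succ_ne_zero, if_true, if_false, sub_zero]

/-!
STATEMENT 9: (λ, s) is cylindric with s ∈ S_e if and only if s ∈ S_e, the s-symbol of
λ is semistandard, and the ξ(s)-symbol of ξ(λ) is semistandard.
-/
theorem cylindric_iff_symbol_and_cycled_symbol_semistandard
    (l e : ℕ) (he : 2 ≤ e) (s : Fin (l + 1) → ℤ) (Λ : MultiPartition l) :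
    (InSe e s ∧ Cylindric e s Λ) ↔
      (InSe e s ∧ Semistandard s Λ ∧ Semistandard (xiCharge e s) (xiMP Λ)) := by
  refine and_congr_right fun hs => ?_
  have hmono : ∀ c : Fin l, s c.castSucc ≤ s c.succ := fun c =>
    sub_nonneg.1 (hs _ _ c.castSucc_lt_succ).1
  have hsemi : Semistandard s Λ ↔ ∀ c : Fin l, ∀ a : ℕ, 1 ≤ a →
      (Λ c.succ).part (a + (s c.succ - s c.castSucc).toNat) ≤ (Λ c.castSucc).part a := by
    simp only [semistandard_iff, chargedDominates_iff, hmono, true_and]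
  rw [Cylindric, ← hsemi]
  refine and_congr_right fun h => ?_
  cases l with
  | zero =>
    refine ⟨fun _ => (semistandard_iff _ _).2 fun c => c.elim0, fun _ a ha => ?_⟩
    exact (Λ 0).part_le_part ha (Nat.le_add_right _ _)
  | succ l =>
    have hlast : s (Fin.last _) - e ≤ s 0 := by
      have := (hs 0 (Fin.last _) (Fin.last_pos)).2
      omega
    rw [semistandard_iff] at h
    have hshift : (e : ℤ) + s 0 - s (Fin.last _) = s 0 - (s (Fin.last _) - e) := by ring
    rw [semistandard_xi_iff, and_iff_left fun c : Fin l => h c.castSucc, chargedDominates_iff,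
      and_iff_right hlast, hshift]

end FockCrystal
end

section
/- Fix integers l ≥ 1 and e ≥ 2, let s ∈ ℤ^l, λ an l-partition, and i ∈ {0,…,e−1}. Consider the cyclage ξ(s) = (s_l − e, s_1, …, s_{l−1}), ξ(λ) = (λ^l, λ^1, …, λ^{l−1}), and the bijection on nodes sending (a,b,c) to (a,b,c+1) for c < l and (a,b,l) to (a,b,1). Then: (1) a node γ is the good addable i-node of (λ,s) if and only if its image is the good addable i-node of (ξ(λ),ξ(s)); consequently ξ(f̃_i λ) = f̃_i(ξ λ) whenever f̃_i acts nontrivially, and f̃_i λ = 0 iff f̃_i(ξλ) = 0. (2) The same holds for good removable i-nodes and the operators ẽ_i. -/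
namespace FockCrystal

variable {l : ℕ}

/-- The bijection `xiNode` on nodes, as an equivalence. -/
def xiNodeEquiv (l : ℕ) : Node l ≃ Node l where
  toFun := xiNode
  invFun γ := ⟨γ.row, γ.col, (rho l).symm γ.comp⟩
  left_inv γ := by simp [xiNode]
  right_inv γ := by simp [xiNode]

/-- The action of `xiNode` on letters of words. -/
def xiLetter (l : ℕ) : Node l × Letter ≃ Node l × Letter :=
  (xiNodeEquiv l).prodCongr (Equiv.refl _)

theorem xiLetter_mk (γ : Node l) (x : Letter) : xiLetter l (γ, x) = (xiNode γ, x) := rfl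

@[simp]
theorem xiLetter_snd (p : Node l × Letter) : (xiLetter l p).2 = p.2 := rfl

@[simp]
theorem xiLetter_fst (p : Node l × Letter) : (xiLetter l p).1 = xiNode p.1 := rfl

theorem addable_xi {Λ : MultiPartition l} {γ : Node l} :
    Addable (xiMP Λ) (xiNode γ) ↔ Addable Λ γ := by
  simp [Addable, xiMP, xiNode]

theorem removable_xi {Λ : MultiPartition l} {γ : Node l} :
    Removable (xiMP Λ) (xiNode γ) ↔ Removable Λ γ := by
  simp [Removable, xiMP, xiNode]

theorem rho_eq_zero_iff {c : Fin (l + 1)} : rho l c = 0 ↔ c = Fin.last l := by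
  rw [← (rho l).injective.eq_iff (b := Fin.last l)]
  simp [rho]

theorem content_xi (s : Fin (l + 1) → ℤ) (e : ℕ) (γ : Node l) :
    content (xiCharge e s) (xiNode γ) =
      content s γ - if γ.comp = Fin.last l then (e : ℤ) else 0 := by
  simp only [content, xiCharge, xiNode, Equiv.symm_apply_apply, rho_eq_zero_iff]
  ring

theorem content_xi_emod (s : Fin (l + 1) → ℤ) (e : ℕ) (γ : Node l) :
    content (xiCharge e s) (xiNode γ) % (e : ℤ) = content s γ % (e : ℤ) := by
  rw [content_xi]
  split_ifs <;> simp

theorem rho_lt_rho_iff {c d : Fin (l + 1)} (hc : c ≠ Fin.last l) (hd : d ≠ Fin.last l) :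
    rho l c < rho l d ↔ c < d := by
  rw [Fin.lt_def, Fin.lt_def, rho, coe_finRotate_of_ne_last hc, coe_finRotate_of_ne_last hd]
  omega

/-- On nodes of equal residue, `xiNode` preserves and reflects the order `≺`. -/
theorem nodeLt_xi {s : Fin (l + 1) → ℤ} {e : ℕ} (he : 0 < e) {γ δ : Node l}
    (h : content s γ % (e : ℤ) = content s δ % (e : ℤ)) :
    NodeLt (xiCharge e s) (xiNode γ) (xiNode δ) ↔ NodeLt s γ δ := by
  have he' : (0 : ℤ) < e := by exact_mod_cast he
  obtain ⟨k, hk⟩ := Int.ModEq.dvd (show content s γ ≡ content s δ [ZMOD e] from h)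
  have le_of_lt_add : content s γ < content s δ + e → content s γ ≤ content s δ := by
    intro hlt
    have : -1 < k := by nlinarith
    nlinarith
  have add_le_of_lt : content s γ < content s δ → content s γ + e ≤ content s δ := by
    intro hlt
    have : 0 < k := by nlinarith
    nlinarith
  simp only [NodeLt, content_xi]
  have hcomp (η : Node l) : (xiNode η).comp = rho l η.comp := rfl
  rw [hcomp, hcomp]
  by_cases hγ : γ.comp = Fin.last l <;> by_cases hδ : δ.comp = Fin.last l
  · simp [hγ, hδ]
  · have hlt : δ.comp < γ.comp := hγ ▸ Fin.lt_last_iff_ne_last.2 hδ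
    have hnot : ¬ rho l δ.comp < rho l γ.comp := by
      rw [rho_eq_zero_iff.2 hγ]
      exact Fin.not_lt_zero _
    simp only [hγ, hδ, if_true, if_false] at hlt hnot ⊢
    simp only [hlt, hnot, and_true, and_false, or_false]
    constructor
    · intro h'
      have := le_of_lt_add (by linarith)
      omega
    · intro h'
      omega
  · have hnot : ¬ δ.comp < γ.comp := by
      rw [hδ]
      exact (Fin.le_last _).not_gt
    have hlt : rho l δ.comp < rho l γ.comp := by
      rw [rho_eq_zero_iff.2 hδ, Fin.pos_iff_ne_zero, Ne, rho_eq_zero_iff]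
      exact hγ
    simp only [hγ, hδ, if_true, if_false] at hlt hnot ⊢
    simp only [hlt, hnot, and_true, and_false, or_false]
    constructor
    · intro h'
      omega
    · intro h'
      have := add_le_of_lt h'
      omega
  · simp [hγ, hδ, rho_lt_rho_iff hδ hγ]

theorem isWordE_map_xiLetter {Λ : MultiPartition l} {s : Fin (l + 1) → ℤ} {e : ℕ}
    (he : 0 < e) {i : ℤ} {w : List (Node l × Letter)} :
    IsWordE (xiMP Λ) (xiCharge e s) e i (w.map (xiLetter l)) ↔ IsWordE Λ s e i w := by
  have hmem : (∀ γ : Node l, (∃ x, (γ, x) ∈ w.map (xiLetter l)) ↔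
      ((Addable (xiMP Λ) γ ∨ Removable (xiMP Λ) γ) ∧
        content (xiCharge e s) γ % (e : ℤ) = i)) ↔
      ∀ γ : Node l, (∃ x, (γ, x) ∈ w) ↔
        ((Addable Λ γ ∨ Removable Λ γ) ∧ content s γ % (e : ℤ) = i) := by
    rw [← (xiNodeEquiv l).forall_congr_right]
    refine forall_congr' fun γ => ?_
    rw [show xiNodeEquiv l γ = xiNode γ from rfl, addable_xi, removable_xi, content_xi_emod]
    simp only [← xiLetter_mk, List.mem_map_of_injective (xiLetter l).injective]
  have hletter : (∀ p ∈ w.map (xiLetter l), LetterOk (xiMP Λ) p) ↔ ∀ p ∈ w, LetterOk Λ p := by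
    simp only [List.forall_mem_map, LetterOk, xiLetter_snd, xiLetter_fst, addable_xi,
      removable_xi]
  unfold IsWordE
  rw [hmem, hletter, List.pairwise_map]
  refine and_congr_left fun ⟨hw, _⟩ => List.Pairwise.iff_of_mem fun {p q} hp hq => ?_
  exact nodeLt_xi he (((hw p.1).1 ⟨p.2, hp⟩).2.trans ((hw q.1).1 ⟨q.2, hq⟩).2.symm)

theorem reduceW_map_xiLetter (w : List (Node l × Letter)) :
    reduceW (w.map (xiLetter l)) = (reduceW w).map (xiLetter l) := by
  induction w with
  | nil => rfl
  | cons p ps ih =>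
    simp only [List.map_cons, reduceW, ih]
    cases reduceW ps with
    | nil => rfl
    | cons q qs =>
      by_cases h : p.2 = Letter.R ∧ q.2 = Letter.A <;> simp [h]

theorem map_xiLetter_eq_append_cons_iff {w u v : List (Node l × Letter)}
    {γ : Node l} {x : Letter} :
    w.map (xiLetter l) = u.map (xiLetter l) ++ (xiNode γ, x) :: v.map (xiLetter l) ↔
      w = u ++ (γ, x) :: v := by
  rw [← xiLetter_mk, ← List.map_cons, ← List.map_append]
  exact (List.map_injective_iff.2 (xiLetter l).injective).eq_iff

theorem surjective_map_xiLetter :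
    Function.Surjective (List.map (xiLetter l)) :=
  List.map_surjective_iff.2 (xiLetter l).surjective

theorem goodAddableWord_map_xiLetter {w : List (Node l × Letter)} {γ : Node l} :
    GoodAddableWord (w.map (xiLetter l)) (xiNode γ) ↔ GoodAddableWord w γ := by
  unfold GoodAddableWord
  rw [surjective_map_xiLetter.exists₂]
  simp only [reduceW_map_xiLetter,
    map_xiLetter_eq_append_cons_iff, List.forall_mem_map, xiLetter_snd]

theorem goodRemovableWord_map_xiLetter {w : List (Node l × Letter)} {γ : Node l} :
    GoodRemovableWord (w.map (xiLetter l)) (xiNode γ) ↔ GoodRemovableWord w γ := by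
  unfold GoodRemovableWord
  rw [surjective_map_xiLetter.exists₂]
  simp only [reduceW_map_xiLetter,
    map_xiLetter_eq_append_cons_iff, List.forall_mem_map, xiLetter_snd]

theorem goodAddable_xi {Λ : MultiPartition l} {s : Fin (l + 1) → ℤ} {e : ℕ} (he : 0 < e)
    {i : ℤ} {γ : Node l} :
    GoodAddable (xiMP Λ) (xiCharge e s) e i (xiNode γ) ↔ GoodAddable Λ s e i γ := by
  unfold GoodAddable
  rw [surjective_map_xiLetter.exists]
  simp only [isWordE_map_xiLetter he,
    goodAddableWord_map_xiLetter]

theorem goodRemovable_xi {Λ : MultiPartition l} {s : Fin (l + 1) → ℤ} {e : ℕ} (he : 0 < e)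
    {i : ℤ} {γ : Node l} :
    GoodRemovable (xiMP Λ) (xiCharge e s) e i (xiNode γ) ↔ GoodRemovable Λ s e i γ := by
  unfold GoodRemovable
  rw [surjective_map_xiLetter.exists]
  simp only [isWordE_map_xiLetter he,
    goodRemovableWord_map_xiLetter]

theorem AddNode.xi {Λ Λ' : MultiPartition l} {γ : Node l} (h : AddNode Λ Λ' γ) :
    AddNode (xiMP Λ) (xiMP Λ') (xiNode γ) := by
  obtain ⟨h₁, h₂, h₃⟩ := h
  refine ⟨by simpa [xiMP, xiNode] using h₁, by simpa [xiMP, xiNode] using h₂, fun c hc => ?_⟩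
  refine h₃ _ fun h => hc ?_
  rw [← (rho l).apply_symm_apply c, h]
  rfl

/-!
STATEMENT 10: the cyclage ξ (on charged multipartitions, with node bijection
(a,b,c) ↦ (a,b,c+1) cyclically) transports good addable/removable i-nodes to good
addable/removable i-nodes; consequently ξ commutes with f̃_i and ẽ_i whenever they act
nontrivially, and f̃_i λ = 0 iff f̃_i (ξλ) = 0 (and similarly for ẽ_i).
-/
theorem cyclage_is_crystal_isomorphism
    (l e : ℕ) (he : 2 ≤ e) (s : Fin (l + 1) → ℤ) (Λ : MultiPartition l)
    (i : ℕ) (hi : i < e) :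
    (∀ γ : Node l, GoodAddable Λ s e (i : ℤ) γ ↔
        GoodAddable (xiMP Λ) (xiCharge e s) e (i : ℤ) (xiNode γ)) ∧
    (∀ γ : Node l, GoodRemovable Λ s e (i : ℤ) γ ↔
        GoodRemovable (xiMP Λ) (xiCharge e s) e (i : ℤ) (xiNode γ)) ∧
    (∀ (γ : Node l) (Λ' : MultiPartition l), GoodAddable Λ s e (i : ℤ) γ →
        AddNode Λ Λ' γ → AddNode (xiMP Λ) (xiMP Λ') (xiNode γ)) ∧
    (∀ (γ : Node l) (Λ' : MultiPartition l), GoodRemovable Λ s e (i : ℤ) γ →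
        AddNode Λ' Λ γ → AddNode (xiMP Λ') (xiMP Λ) (xiNode γ)) ∧
    ((¬ ∃ γ : Node l, GoodAddable Λ s e (i : ℤ) γ) ↔
        ¬ ∃ δ : Node l, GoodAddable (xiMP Λ) (xiCharge e s) e (i : ℤ) δ) ∧
    ((¬ ∃ γ : Node l, GoodRemovable Λ s e (i : ℤ) γ) ↔
        ¬ ∃ δ : Node l, GoodRemovable (xiMP Λ) (xiCharge e s) e (i : ℤ) δ) := by
  have he' : 0 < e := by omega
  have hsurj : Function.Surjective (xiNode (l := l)) := (xiNodeEquiv l).surjective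
  refine ⟨fun γ => (goodAddable_xi he').symm, fun γ => (goodRemovable_xi he').symm,
    fun γ Λ' _ h => h.xi, fun γ Λ' _ h => h.xi, ?_, ?_⟩
  · exact (not_congr (hsurj.exists.trans (exists_congr fun _ => goodAddable_xi he'))).symm
  · exact (not_congr (hsurj.exists.trans (exists_congr fun _ => goodRemovable_xi he'))).symm

end FockCrystal
end

section
/- Fix integers l ≥ 1 and e ≥ 2, let s ∈ S_e and let (λ,s) be cylindric but not FLOTW, with first pseudoperiod P(λ) = (γ_1,…,γ_e), γ_i = (a_i, α, c_i). Then: (1) cont(γ_i) = cont(γ_{i−1}) − 1 for all 2 ≤ i ≤ e, i.e. the contents of the nodes of the pseudoperiod are consecutive decreasing integers; and (2) c_i ≤ c_{i−1} for all 2 ≤ i ≤ e. -/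
namespace FockCrystal

variable {l : ℕ}

/-- The row of `Λ^c` indexed by the shifted content `y`, namely row `s_c − y`, has length at
least `v`; rows of non-positive index are considered infinitely long. -/
def RowGE (s : Fin (l + 1) → ℤ) (Λ : MultiPartition l) (v : ℕ) (c : Fin (l + 1)) (y : ℤ) : Prop :=
  s c - y ≤ 0 ∨ v ≤ (Λ c).part (s c - y).toNat

theorem RowGE.mono {s : Fin (l + 1) → ℤ} {Λ : MultiPartition l} {v : ℕ} {c : Fin (l + 1)}
    {y y' : ℤ} (h : RowGE s Λ v c y) (hy : y ≤ y') : RowGE s Λ v c y' := by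
  by_cases h0 : s c - y' ≤ 0
  · exact Or.inl h0
  · refine Or.inr ?_
    rcases h with h | h
    · omega
    · exact h.trans ((Λ c).part_le_part (by omega) (by omega))

theorem RowGE.castSucc {e : ℕ} {s : Fin (l + 1) → ℤ} {Λ : MultiPartition l} (hs : InSe e s)
    (hcyl : Cylindric e s Λ) {v : ℕ} {c : Fin l} {y : ℤ} (h : RowGE s Λ v c.succ y) :
    RowGE s Λ v c.castSucc y := by
  by_cases h0 : s c.castSucc - y ≤ 0
  · exact Or.inl h0
  · have hd := (hs c.castSucc c.succ Fin.castSucc_lt_succ).1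
    have hc := hcyl.1 c (s c.castSucc - y).toNat (by omega)
    rw [show (s c.castSucc - y).toNat + (s c.succ - s c.castSucc).toNat = (s c.succ - y).toNat by
      omega] at hc
    rcases h with h | h
    · omega
    · exact Or.inr (h.trans hc)

theorem RowGE.of_le {e : ℕ} {s : Fin (l + 1) → ℤ} {Λ : MultiPartition l} (hs : InSe e s)
    (hcyl : Cylindric e s Λ) {v : ℕ} {c c' : Fin (l + 1)} {y : ℤ} (hcc : c ≤ c')
    (h : RowGE s Λ v c' y) : RowGE s Λ v c y := by
  induction c' using Fin.induction with
  | zero => rwa [Fin.le_zero_iff.1 hcc]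
  | succ i ih =>
    rcases hcc.eq_or_lt with rfl | hlt
    · exact h
    · exact ih (Fin.le_castSucc_iff.2 hlt) (h.castSucc hs hcyl)

theorem RowGE.last {e : ℕ} (he : 0 < e) {s : Fin (l + 1) → ℤ} {Λ : MultiPartition l}
    (hs : InSe e s) (hcyl : Cylindric e s Λ) {v : ℕ} {y : ℤ} (h : RowGE s Λ v 0 (y - e)) :
    RowGE s Λ v (Fin.last l) y := by
  by_cases h0 : s (Fin.last l) - y ≤ 0
  · exact Or.inl h0
  · have hd : s (Fin.last l) - s 0 < e := by
      rcases (Fin.zero_le (Fin.last l)).eq_or_lt with h | h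
      · rw [← h]
        omega
      · exact (hs _ _ h).2
    have hc := hcyl.2 (s (Fin.last l) - y).toNat (by omega)
    rw [show (s (Fin.last l) - y).toNat + ((e : ℤ) + s 0 - s (Fin.last l)).toNat
      = (s 0 - (y - e)).toNat by omega] at hc
    rcases h with h | h
    · omega
    · exact Or.inr (h.trans hc)

theorem RightmostAt.rowGE {s : Fin (l + 1) → ℤ} {Λ : MultiPartition l} {α : ℕ} {γ : Node l}
    (h : RightmostAt Λ α γ) :
    RowGE s Λ α γ.comp (content s γ - α) ∧ ¬ RowGE s Λ (α + 1) γ.comp (content s γ - α) := by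
  obtain ⟨h1, h2, h3⟩ := h
  have hrow : s γ.comp - (content s γ - α) = γ.row := by
    rw [content, h2]
    ring
  unfold RowGE
  rw [hrow, Int.toNat_natCast, h3]
  omega

theorem exists_rightmostAt {s : Fin (l + 1) → ℤ} {Λ : MultiPartition l} {α : ℕ}
    {c : Fin (l + 1)} {x : ℤ} (h : RowGE s Λ α c (x - α)) (h' : ¬ RowGE s Λ (α + 1) c (x - α)) :
    ∃ γ : Node l, RightmostAt Λ α γ ∧ content s γ = x ∧ γ.comp = c := by
  unfold RowGE at h h'
  refine ⟨⟨(s c - (x - α)).toNat, α, c⟩, ⟨?_, rfl, ?_⟩, ?_, rfl⟩ <;> simp only [content] <;> omega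

/-- If the residues of the parts of size `α` cover everything, then the `e` largest integers up to
the maximal content all occur as contents of rightmost nodes of parts of size `α`. -/
theorem exists_rightmostAt_content_eq {e : ℕ} (he : 0 < e) {s : Fin (l + 1) → ℤ}
    {Λ : MultiPartition l} {α : ℕ} (hs : InSe e s) (hcyl : Cylindric e s Λ)
    (hcov : Covers e s Λ α) {γ₀ : Node l} (hγ₀ : RightmostAt Λ α γ₀)
    (hmax : ∀ γ, RightmostAt Λ α γ → content s γ ≤ content s γ₀) {x : ℤ}
    (hx : content s γ₀ - e < x) (hx' : x ≤ content s γ₀) :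
    ∃ γ : Node l, RightmostAt Λ α γ ∧ content s γ = x := by
  have he' : (0 : ℤ) < e := by exact_mod_cast he
  obtain ⟨γ, hγ, hr⟩ := hcov (x % e) (Int.emod_nonneg _ he'.ne') (Int.emod_lt_of_pos _ he')
  obtain ⟨k, hk⟩ : (e : ℤ) ∣ content s γ - x := Int.ModEq.dvd hr.symm
  rcases lt_trichotomy k 0 with hk0 | rfl | hk0
  · have hle : content s γ - α ≤ x - α - e := by nlinarith
    have hlast := ((hγ.rowGE (s := s)).1.mono hle |>.of_le hs hcyl (Fin.zero_le _)).last he hs hcyl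
    obtain ⟨γ', h1, h2, -⟩ := exists_rightmostAt (hlast.of_le hs hcyl (Fin.le_last γ₀.comp))
      fun h => (hγ₀.rowGE (s := s)).2 (h.mono (by omega))
    exact ⟨γ', h1, h2⟩
  · exact ⟨γ, hγ, by linarith⟩
  · have := hmax γ hγ
    nlinarith

/-!
STATEMENT 11: in the first pseudoperiod P(λ) = (γ_1,…,γ_e) of a cylindric non-FLOTW
(λ, s), the contents of the nodes are consecutive decreasing integers,
cont(γ_{i+1}) = cont(γ_i) − 1, and the component indices satisfy c_{i+1} ≤ c_i.
(Here the nodes are indexed γ_1 = P 0, …, γ_e = P (e−1).)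
-/
theorem pseudoperiod_contents_consecutive_and_components_decreasing
    (l e : ℕ) (he : 2 ≤ e) (s : Fin (l + 1) → ℤ) (Λ : MultiPartition l)
    (α : ℕ) (P : ℕ → Node l)
    (hs : InSe e s) (hcyl : Cylindric e s Λ) (hnf : ¬ FLOTW e s Λ)
    (hP : IsFirstPseudoperiod e s Λ α P) :
    ∀ i : ℕ, i + 1 < e →
      content s (P (i + 1)) = content s (P i) - 1 ∧
      (P (i + 1)).comp ≤ (P i).comp := by
  obtain ⟨-, hcov, -, hmem, hmax, -, hstep⟩ := hP
  have hcont : ∀ i : ℕ, i < e → content s (P i) = content s (P 0) - i := by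
    intro i
    induction i with
    | zero => simp
    | succ i ih =>
      intro hi
      have hi' := ih (by omega)
      obtain ⟨γ, hγ, hγc⟩ := exists_rightmostAt_content_eq (by omega) hs hcyl hcov
        (hmem 0 (by omega)) hmax (x := content s (P 0) - (i + 1)) (by omega) (by omega)
      have h1 := (hstep i hi).1
      have h2 := (hstep i hi).2.1 γ hγ (by omega)
      push_cast
      omega
  intro i hi
  have hc : content s (P (i + 1)) = content s (P i) - 1 := by
    rw [hcont i (by omega), hcont (i + 1) hi]
    push_cast
    ring
  refine ⟨hc, ?_⟩
  by_contra! hlt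
  obtain ⟨γ, hγ, hγc, hcomp⟩ := exists_rightmostAt
    (((hmem (i + 1) hi).rowGE (s := s)).1.of_le hs hcyl hlt.le)
    fun h => ((hmem i (by omega)).rowGE (s := s)).2 (h.mono (by omega))
  have hmin := (hstep i hi).2.2 γ hγ hγc
  rw [hcomp] at hmin
  exact absurd hlt hmin.not_gt

end FockCrystal
end
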